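/- The function G attains its maximum over all subsets of N at both T = D and T = D': G(D) = G(D') = max over T ⊆ N of G(T), where D is the unique largest strictly decodable subset of N and D' is the unique largest weakly decodable subset of N. -/

import Mathlib

open scoped BigOperators

/-- Shannon entropy (natural log) of a random variable `X` on a finite sample
space `Ω` with probability mass function `μ`. -/
noncomputable def entropy {Ω α : Type*} [Fintype Ω] [Fintype α] [DecidableEq α]
    (μ : Ω → ℝ) (X : Ω → α) : ℝ :=
  ∑ a : α, Real.negMulLog (∑ ω ∈ Finset.univ.filter (fun ω => X ω = a), μ ω)

/-- Conditional mutual information `I(X;Y|Z)` for random variables on a finite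
sample space with pmf `μ`. -/
noncomputable def condMI {Ω α β γ : Type*} [Fintype Ω]
    [Fintype α] [DecidableEq α] [Fintype β] [DecidableEq β] [Fintype γ] [DecidableEq γ]
    (μ : Ω → ℝ) (X : Ω → α) (Y : Ω → β) (Z : Ω → γ) : ℝ :=
  entropy μ (fun ω => (X ω, Z ω)) + entropy μ (fun ω => (Y ω, Z ω))
    - entropy μ (fun ω => (X ω, Y ω, Z ω)) - entropy μ Z

/-- Sample space for the compress-and-forward multiple-relay channel:
a value of `(x₀, (xᵢ)ᵢ, (yᵢ)ᵢ, y_{n+1}, (ŷᵢ)ᵢ)`. -/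
abbrev CFOmega {n : ℕ} (X0A : Type) (XA YA : Fin n → Type) (YdA : Type)
    (YhA : Fin n → Type) : Type :=
  X0A × (∀ i, XA i) × (∀ i, YA i) × YdA × (∀ i, YhA i)

section CF

variable {n : ℕ} {X0A YdA : Type} {XA YA YhA : Fin n → Type}

/-- The source input `X₀`. -/
def rvX0 : CFOmega X0A XA YA YdA YhA → X0A := fun ω => ω.1

/-- The tuple of relay inputs `X_S = (Xᵢ)_{i∈S}`. -/
def rvXS (S : Finset (Fin n)) : CFOmega X0A XA YA YdA YhA → (∀ i : S, XA i) :=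
  fun ω i => ω.2.1 i

/-- The tuple of relay outputs `Y_S = (Yᵢ)_{i∈S}`. -/
def rvYS (S : Finset (Fin n)) : CFOmega X0A XA YA YdA YhA → (∀ i : S, YA i) :=
  fun ω i => ω.2.2.1 i

/-- The destination output `Y_{n+1}`. -/
def rvYd : CFOmega X0A XA YA YdA YhA → YdA := fun ω => ω.2.2.2.1

/-- The tuple of compressions `Ŷ_S = (Ŷᵢ)_{i∈S}`. -/
def rvYhS (S : Finset (Fin n)) : CFOmega X0A XA YA YdA YhA → (∀ i : S, YhA i) :=
  fun ω i => ω.2.2.2.2 i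

/-- The joint pmf
`p(x₀)·∏ᵢ p(xᵢ) · p(y₁,…,y_{n+1}|x₀,…,x_n) · ∏ᵢ p(ŷᵢ|yᵢ,xᵢ)`. -/
noncomputable def muCF (p0 : X0A → ℝ) (pX : ∀ i, XA i → ℝ)
    (W : X0A → (∀ i, XA i) → ((∀ i, YA i) × YdA) → ℝ)
    (κ : ∀ i, YA i → XA i → YhA i → ℝ) :
    CFOmega X0A XA YA YdA YhA → ℝ :=
  fun ω => p0 ω.1 * (∏ i, pX i (ω.2.1 i)) * W ω.1 ω.2.1 (ω.2.2.1, ω.2.2.2.1)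
    * ∏ i, κ i (ω.2.2.1 i) (ω.2.1 i) (ω.2.2.2.2 i)

variable [Fintype X0A] [DecidableEq X0A] [Fintype YdA] [DecidableEq YdA]
  [∀ i, Fintype (XA i)] [∀ i, DecidableEq (XA i)]
  [∀ i, Fintype (YA i)] [∀ i, DecidableEq (YA i)]
  [∀ i, Fintype (YhA i)] [∀ i, DecidableEq (YhA i)]

/-- `I(X_S; Ŷ_{D∖S}, Y_{n+1} | X_0, X_{D∖S}) − I(Y_S; Ŷ_S | X_0, X_D, Y_{n+1}, Ŷ_{D∖S})`. -/
noncomputable def cfGap (μ : CFOmega X0A XA YA YdA YhA → ℝ) (D S : Finset (Fin n)) : ℝ :=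
  condMI μ (rvXS S) (fun ω => (rvYhS (D \ S) ω, rvYd ω))
    (fun ω => (rvX0 ω, rvXS (D \ S) ω))
  - condMI μ (rvYS S) (rvYhS S)
    (fun ω => (rvX0 ω, rvXS D ω, rvYd ω, rvYhS (D \ S) ω))

/-- `D ⊆ N` is weakly decodable if for every `S ⊆ D`,
`I(X_S; Ŷ_{D∖S}, Y_{n+1} | X_0, X_{D∖S}) − I(Y_S; Ŷ_S | X_0, X_D, Y_{n+1}, Ŷ_{D∖S}) ≥ 0`. -/
def WeaklyDecodable (μ : CFOmega X0A XA YA YdA YhA → ℝ) (D : Finset (Fin n)) : Prop :=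
  ∀ S ⊆ D, 0 ≤ cfGap μ D S

/-- `D ⊆ N` is strictly decodable if for every nonempty `S ⊆ D`,
`I(X_S; Ŷ_{D∖S}, Y_{n+1} | X_0, X_{D∖S}) − I(Y_S; Ŷ_S | X_0, X_D, Y_{n+1}, Ŷ_{D∖S}) > 0`. -/
def StrictlyDecodable (μ : CFOmega X0A XA YA YdA YhA → ℝ) (D : Finset (Fin n)) : Prop :=
  ∀ S ⊆ D, S.Nonempty → 0 < cfGap μ D S

/-- `G(T) = min_{S ⊆ T} [ I(X_0, X_S; Ŷ_{T∖S}, Y_{n+1} | X_{T∖S})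
  − I(Y_S; Ŷ_S | X_0, X_T, Y_{n+1}, Ŷ_{T∖S}) ]`. -/
noncomputable def Gfun (μ : CFOmega X0A XA YA YdA YhA → ℝ) (T : Finset (Fin n)) : ℝ :=
  T.powerset.inf' (Finset.powerset_nonempty T) fun S =>
    condMI μ (fun ω => (rvX0 ω, rvXS S ω)) (fun ω => (rvYhS (T \ S) ω, rvYd ω))
      (rvXS (T \ S))
    - condMI μ (rvYS S) (rvYhS S)
      (fun ω => (rvX0 ω, rvXS T ω, rvYd ω, rvYhS (T \ S) ω))

end CF

section Entropy

variable {Ω α β γ : Type*} [Fintype Ω]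

/-- The expectation of `-log q` under the mass function `μ`. -/
noncomputable def expNegLog (μ q : Ω → ℝ) : ℝ := -∑ ω, μ ω * Real.log (q ω)

/-- The mass that `μ` gives to the event that `X` takes the value `a`. -/
noncomputable def mass [DecidableEq α] (μ : Ω → ℝ) (X : Ω → α) (a : α) : ℝ :=
  ∑ ω ∈ Finset.univ.filter (fun ω => X ω = a), μ ω

lemma sum_mul_comp_eq_sum_mass [Fintype α] [DecidableEq α] (μ : Ω → ℝ) (X : Ω → α) (g : α → ℝ) :
    ∑ ω, μ ω * g (X ω) = ∑ a, mass μ X a * g a := by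
  rw [← Finset.sum_fiberwise (s := Finset.univ) (g := X)]
  refine Finset.sum_congr rfl fun a _ => ?_
  rw [mass, Finset.sum_mul]
  refine Finset.sum_congr rfl fun ω hω => ?_
  rw [(Finset.mem_filter.1 hω).2]

lemma sum_mass [Fintype α] [DecidableEq α] (μ : Ω → ℝ) (X : Ω → α) :
    ∑ a, mass μ X a = ∑ ω, μ ω := by
  simpa using (sum_mul_comp_eq_sum_mass μ X fun _ => 1).symm

lemma mass_nonneg [DecidableEq α] {μ : Ω → ℝ} (hμ : ∀ ω, 0 ≤ μ ω) (X : Ω → α) (a : α) :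
    0 ≤ mass μ X a :=
  Finset.sum_nonneg fun ω _ => hμ ω

lemma mass_pos [DecidableEq α] {μ : Ω → ℝ} (hμ : ∀ ω, 0 ≤ μ ω) (X : Ω → α) {ω : Ω}
    (h : 0 < μ ω) : 0 < mass μ X (X ω) :=
  h.trans_le (Finset.single_le_sum (f := μ) (fun ω _ => hμ ω) (by simp))

lemma entropy_eq_expNegLog [Fintype α] [DecidableEq α] (μ : Ω → ℝ) (X : Ω → α) :
    entropy μ X = expNegLog μ fun ω => mass μ X (X ω) := by
  rw [expNegLog, sum_mul_comp_eq_sum_mass μ X fun a => Real.log (mass μ X a), entropy,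
    ← Finset.sum_neg_distrib]
  refine Finset.sum_congr rfl fun a _ => ?_
  simp [Real.negMulLog, mass]

/-- Entropy depends only on the partition of the sample space induced by the variable. -/
lemma entropy_congr [Fintype α] [DecidableEq α] [Fintype β] [DecidableEq β] (μ : Ω → ℝ)
    {X : Ω → α} {Y : Ω → β} (h : ∀ ω ω', X ω = X ω' ↔ Y ω = Y ω') :
    entropy μ X = entropy μ Y := by
  simp only [entropy_eq_expNegLog, mass, h]

lemma entropy_comp [Fintype α] [DecidableEq α] [Fintype β] [DecidableEq β] (μ : Ω → ℝ)
    (π : Ω → α) (f : α → β) :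
    entropy μ (fun ω => f (π ω)) = entropy (mass μ π) f := by
  have key : ∀ b, mass μ (fun ω => f (π ω)) b = mass (mass μ π) f b := fun b => by
    have := sum_mul_comp_eq_sum_mass μ π fun a => if f a = b then 1 else 0
    simpa [mass, Finset.sum_filter] using this
  exact Finset.sum_congr rfl fun b _ => congrArg Real.negMulLog (key b)

lemma sum_mass_pair_left [Fintype α] [DecidableEq α] [DecidableEq β] (μ : Ω → ℝ)
    (X : Ω → α) (Z : Ω → β) (z : β) :
    ∑ x, mass μ (fun ω => (X ω, Z ω)) (x, z) = mass μ Z z := by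
  have := Finset.sum_fiberwise (s := Finset.univ.filter fun ω => Z ω = z) (g := X) (f := μ)
  rw [mass, ← this]
  refine Finset.sum_congr rfl fun x _ => ?_
  rw [mass, Finset.filter_filter]
  simp [and_comm]

lemma condMI_nonneg [Fintype α] [DecidableEq α] [Fintype β] [DecidableEq β] [Fintype γ]
    [DecidableEq γ] {μ : Ω → ℝ} (hμ : ∀ ω, 0 ≤ μ ω) (X : Ω → α) (Y : Ω → β) (Z : Ω → γ) :
    0 ≤ condMI μ X Y Z := by
  set P : α × β × γ → ℝ := mass μ fun ω => (X ω, Y ω, Z ω) with hP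
  set Q : α × γ → ℝ := mass μ fun ω => (X ω, Z ω) with hQ
  set R : β × γ → ℝ := mass μ fun ω => (Y ω, Z ω) with hR
  set S : γ → ℝ := mass μ Z with hS
  have hP0 : ∀ a, 0 ≤ P a := mass_nonneg hμ _
  have hQ0 : ∀ a, 0 ≤ Q a := mass_nonneg hμ _
  have hR0 : ∀ a, 0 ≤ R a := mass_nonneg hμ _
  have hS0 : ∀ a, 0 ≤ S a := mass_nonneg hμ _
  let t : α × β × γ → ℝ := fun a => Q (a.1, a.2.2) * R a.2 / (P a * S a.2.2)
  have bound : ∑ a, P a * t a ≤ ∑ ω, μ ω := by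
    calc ∑ a, P a * t a ≤ ∑ a : α × β × γ, Q (a.1, a.2.2) * R a.2 / S a.2.2 := by
          refine Finset.sum_le_sum fun a _ => ?_
          rcases (hP0 a).eq_or_lt with h | h
          · rw [← h, zero_mul]
            exact div_nonneg (mul_nonneg (hQ0 _) (hR0 _)) (hS0 _)
          · refine le_of_eq ?_
            simp only [t]
            rw [mul_div_assoc', mul_div_mul_left _ _ h.ne']
      _ = ∑ z, (∑ x, Q (x, z)) * (∑ y, R (y, z)) / S z := by
          rw [Fintype.sum_prod_type]
          simp only [Fintype.sum_prod_type]
          simp only [Finset.sum_mul_sum, Finset.sum_div]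
          rw [Finset.sum_congr rfl fun x _ => Finset.sum_comm, Finset.sum_comm]
      _ = ∑ z, S z := by
          refine Finset.sum_congr rfl fun z _ => ?_
          rw [hQ, hR, sum_mass_pair_left, sum_mass_pair_left, mul_self_div_self]
      _ = ∑ ω, μ ω := sum_mass μ Z
  rw [← sum_mul_comp_eq_sum_mass] at bound
  have key : ∑ ω, (μ ω - μ ω * t (X ω, Y ω, Z ω)) ≤ condMI μ X Y Z := by
    simp only [condMI, entropy_eq_expNegLog, expNegLog]
    rw [← Finset.sum_neg_distrib, ← Finset.sum_neg_distrib, ← Finset.sum_neg_distrib,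
      ← Finset.sum_neg_distrib, ← Finset.sum_add_distrib, ← Finset.sum_sub_distrib,
      ← Finset.sum_sub_distrib]
    refine Finset.sum_le_sum fun ω _ => ?_
    rcases (hμ ω).eq_or_lt with h | h
    · simp [← h]
    have p : 0 < P (X ω, Y ω, Z ω) := mass_pos hμ (fun ω => (X ω, Y ω, Z ω)) h
    have q : 0 < Q (X ω, Z ω) := mass_pos hμ (fun ω => (X ω, Z ω)) h
    have r : 0 < R (Y ω, Z ω) := mass_pos hμ (fun ω => (Y ω, Z ω)) h
    have s : 0 < S (Z ω) := mass_pos hμ Z h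
    have hlog := Real.log_le_sub_one_of_pos
      (show 0 < t (X ω, Y ω, Z ω) from div_pos (mul_pos q r) (mul_pos p s))
    simp only [t] at hlog ⊢
    rw [Real.log_div (mul_pos q r).ne' (mul_pos p s).ne', Real.log_mul q.ne' r.ne',
      Real.log_mul p.ne' s.ne'] at hlog
    have := mul_le_mul_of_nonneg_left hlog h.le
    linarith
  rw [Finset.sum_sub_distrib] at key
  linarith

/-- Chain rule for a variable `V` which can be resampled by `upd` without changing `U`, and whose
conditional probability given `U` is the factor `q` of `μ`. -/
lemma entropy_pair_eq_add_expNegLog [Fintype α] [DecidableEq α] [Fintype β] [DecidableEq β]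
    {μ : Ω → ℝ} (hμ : ∀ ω, 0 ≤ μ ω) (U : Ω → α) (V : Ω → β) (upd : Ω → β → Ω) (m q : Ω → ℝ)
    (hmq : ∀ ω, μ ω = m ω * q ω) (hm : ∀ ω v, m (upd ω v) = m ω)
    (hU : ∀ ω v, U (upd ω v) = U ω) (hV : ∀ ω v, V (upd ω v) = v)
    (hupd : ∀ ω v, upd (upd ω v) (V ω) = ω) (hq : ∀ ω, ∑ v, q (upd ω v) = 1)
    (hqUV : ∀ ω ω', U ω = U ω' → V ω = V ω' → q ω = q ω') :
    entropy μ (fun ω => (U ω, V ω)) = entropy μ U + expNegLog μ q := by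
  have cell : ∀ ω v, mass μ (fun ω => (U ω, V ω)) (U ω, v)
      = q (upd ω v) * mass m (fun ω => (U ω, V ω)) (U ω, V ω) := by
    intro ω v
    rw [mass, mass, Finset.mul_sum]
    refine Finset.sum_nbij' (fun ω' => upd ω' (V ω)) (fun ω' => upd ω' v) ?_ ?_ ?_ ?_ ?_
    · intro ω' h
      simp_all
    · intro ω' h
      simp_all
    · intro ω' h
      simp only [Finset.mem_filter, Finset.mem_univ, true_and, Prod.mk.injEq] at h
      rw [← h.2, hupd]
    · intro ω' h
      simp only [Finset.mem_filter, Finset.mem_univ, true_and, Prod.mk.injEq] at h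
      rw [← h.2, hupd]
    · intro ω' h
      simp only [Finset.mem_filter, Finset.mem_univ, true_and, Prod.mk.injEq] at h
      rw [hmq, hm, hqUV ω' (upd ω v) (by rw [hU, h.1]) (by rw [hV, h.2]), mul_comm]
  have total : ∀ ω, mass μ U (U ω) = mass m (fun ω => (U ω, V ω)) (U ω, V ω) := by
    intro ω
    have h1 : mass μ U (U ω) = ∑ v, mass μ (fun ω => (U ω, V ω)) (U ω, v) := by
      rw [← sum_mass_pair_left μ V U]
      refine Finset.sum_congr rfl fun v _ => ?_
      simp only [mass, Prod.mk.injEq, and_comm]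
    rw [h1, Finset.sum_congr rfl fun v _ => cell ω v, ← Finset.sum_mul, hq, one_mul]
  have cond : ∀ ω, mass μ (fun ω => (U ω, V ω)) (U ω, V ω) = mass μ U (U ω) * q ω := by
    intro ω
    rw [cell, total, hqUV (upd ω (V ω)) ω (hU _ _) (hV _ _), mul_comm]
  simp only [entropy_eq_expNegLog, expNegLog]
  rw [← neg_add, ← Finset.sum_add_distrib]
  congr 1
  refine Finset.sum_congr rfl fun ω _ => ?_
  rcases (hμ ω).eq_or_lt with h | h
  · simp [← h]
  have hq0 : q ω ≠ 0 := fun h0 => h.ne' (by rw [hmq, h0, mul_zero])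
  rw [cond, Real.log_mul (mass_pos hμ U h).ne' hq0, mul_add]

end Entropy

section CFEntropy

variable {n : ℕ} {X0A YdA : Type} {XA YA YhA : Fin n → Type}

lemma rvXS_eq_iff (S : Finset (Fin n)) (ω ω' : CFOmega X0A XA YA YdA YhA) :
    rvXS S ω = rvXS S ω' ↔ ∀ i ∈ S, ω.2.1 i = ω'.2.1 i := by
  simp [funext_iff, rvXS]

lemma rvYS_eq_iff (S : Finset (Fin n)) (ω ω' : CFOmega X0A XA YA YdA YhA) :
    rvYS S ω = rvYS S ω' ↔ ∀ i ∈ S, ω.2.2.1 i = ω'.2.2.1 i := by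
  simp [funext_iff, rvYS]

lemma rvYhS_eq_iff (S : Finset (Fin n)) (ω ω' : CFOmega X0A XA YA YdA YhA) :
    rvYhS S ω = rvYhS S ω' ↔ ∀ i ∈ S, ω.2.2.2.2 i = ω'.2.2.2.2 i := by
  simp [funext_iff, rvYhS]

lemma muCF_nonneg {p0 : X0A → ℝ} {pX : ∀ i, XA i → ℝ}
    {W : X0A → (∀ i, XA i) → ((∀ i, YA i) × YdA) → ℝ} {κ : ∀ i, YA i → XA i → YhA i → ℝ}
    (hp0 : ∀ x, 0 ≤ p0 x) (hpX : ∀ i x, 0 ≤ pX i x) (hW : ∀ x0 x y, 0 ≤ W x0 x y)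
    (hκ : ∀ i y x yh, 0 ≤ κ i y x yh) (ω : CFOmega X0A XA YA YdA YhA) :
    0 ≤ muCF p0 pX W κ ω :=
  mul_nonneg (mul_nonneg (mul_nonneg (hp0 _) (Finset.prod_nonneg fun i _ => hpX i _)) (hW _ _ _))
    (Finset.prod_nonneg fun i _ => hκ i _ _ _)

/-- The joint mass function of the independent channel inputs. -/
noncomputable def inputMass (p0 : X0A → ℝ) (pX : ∀ i, XA i → ℝ) : X0A × (∀ i, XA i) → ℝ :=
  fun x => p0 x.1 * ∏ i, pX i (x.2 i)

lemma inputMass_nonneg {p0 : X0A → ℝ} {pX : ∀ i, XA i → ℝ} (hp0 : ∀ x, 0 ≤ p0 x)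
    (hpX : ∀ i x, 0 ≤ pX i x) (x : X0A × (∀ i, XA i)) : 0 ≤ inputMass p0 pX x :=
  mul_nonneg (hp0 _) (Finset.prod_nonneg fun i _ => hpX i _)

variable [Fintype X0A] [DecidableEq X0A] [Fintype YdA] [DecidableEq YdA]
  [∀ i, Fintype (XA i)] [∀ i, DecidableEq (XA i)]
  [∀ i, Fintype (YA i)] [∀ i, DecidableEq (YA i)]
  [∀ i, Fintype (YhA i)] [∀ i, DecidableEq (YhA i)]

omit [DecidableEq YdA] [∀ i, DecidableEq (YA i)] [∀ i, DecidableEq (YhA i)] in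
lemma mass_muCF_inputs {p0 : X0A → ℝ} {pX : ∀ i, XA i → ℝ}
    {W : X0A → (∀ i, XA i) → ((∀ i, YA i) × YdA) → ℝ} {κ : ∀ i, YA i → XA i → YhA i → ℝ}
    (hWs : ∀ x0 x, ∑ y, W x0 x y = 1) (hκs : ∀ i y x, ∑ yh, κ i y x yh = 1) :
    mass (muCF p0 pX W κ) (fun ω => (ω.1, ω.2.1)) = inputMass p0 pX := by
  funext ⟨x0, x⟩
  have hκprod : ∀ y : ∀ i, YA i, ∑ yh : ∀ i, YhA i, ∏ i, κ i (y i) (x i) (yh i) = 1 := by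
    intro y
    rw [← Fintype.prod_sum]
    simp [hκs]
  have hW' := hWs x0 x
  rw [Fintype.sum_prod_type] at hW'
  rw [mass, Finset.sum_filter, Fintype.sum_prod_type, Finset.sum_eq_single x0 (by
    intro b _ hb
    simp [hb]) (by simp), Fintype.sum_prod_type, Finset.sum_eq_single x (by
    intro b _ hb
    simp [hb]) (by simp)]
  simp only [if_true, muCF, Fintype.sum_prod_type, ← Finset.mul_sum, hκprod, mul_one, hW',
    inputMass]

omit [DecidableEq X0A] in
/-- Each relay input contributes its own term to the joint entropy of the inputs. -/
lemma entropy_inputs_pair {α : Type*} [Fintype α] [DecidableEq α] {p0 : X0A → ℝ}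
    {pX : ∀ i, XA i → ℝ} (hp0 : ∀ x, 0 ≤ p0 x) (hpX : ∀ i x, 0 ≤ pX i x)
    (hpXs : ∀ i, ∑ x, pX i x = 1) (i : Fin n) (U : X0A × (∀ i, XA i) → α)
    (hU : ∀ x v, U (x.1, Function.update x.2 i v) = U x) :
    entropy (inputMass p0 pX) (fun x => (U x, x.2 i))
      = entropy (inputMass p0 pX) U + expNegLog (inputMass p0 pX) fun x => pX i (x.2 i) := by
  refine entropy_pair_eq_add_expNegLog (inputMass_nonneg hp0 hpX) U _
    (fun x v => (x.1, Function.update x.2 i v))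
    (fun x => p0 x.1 * ∏ j ∈ Finset.univ.erase i, pX j (x.2 j)) _ ?_ ?_ hU ?_ ?_ ?_ ?_
  · intro x
    rw [inputMass, ← Finset.prod_erase_mul _ _ (Finset.mem_univ i), mul_assoc]
  · intro x v
    congr 1
    refine Finset.prod_congr rfl fun j hj => ?_
    simp only [Function.update_of_ne (Finset.ne_of_mem_erase hj)]
  · simp
  · simp
  · simp [hpXs]
  · intro x x' _ h
    simp only [h]

omit [∀ i, DecidableEq (XA i)] in
lemma entropy_inputs_source {α : Type*} [Fintype α] [DecidableEq α] {p0 : X0A → ℝ}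
    {pX : ∀ i, XA i → ℝ} (hp0 : ∀ x, 0 ≤ p0 x) (hp0s : ∑ x, p0 x = 1) (hpX : ∀ i x, 0 ≤ pX i x)
    (U : (∀ i, XA i) → α) :
    entropy (inputMass p0 pX) (fun x => (U x.2, x.1))
      = entropy (inputMass p0 pX) (fun x => U x.2)
        + expNegLog (inputMass p0 pX) fun x => p0 x.1 := by
  refine entropy_pair_eq_add_expNegLog (inputMass_nonneg hp0 hpX) (fun x => U x.2) _
    (fun x v => (v, x.2)) (fun x => ∏ j, pX j (x.2 j)) _ ?_ ?_ ?_ ?_ ?_ ?_ ?_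
  · intro x
    rw [inputMass, mul_comm]
  · simp
  · simp
  · simp
  · simp
  · simp [hp0s]
  · intro x x' _ h
    simp only [h]

omit [DecidableEq X0A] [DecidableEq YdA] [∀ i, DecidableEq (XA i)]
  [∀ i, DecidableEq (YA i)] in
/-- Adjoining one compression to variables that determine `Y_i` and `X_i` and do not involve
`Ŷ_i` adds a term which depends only on `i`. -/
lemma entropy_compression_pair {α : Type*} [Fintype α] [DecidableEq α] {p0 : X0A → ℝ}
    {pX : ∀ i, XA i → ℝ} {W : X0A → (∀ i, XA i) → ((∀ i, YA i) × YdA) → ℝ}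
    {κ : ∀ i, YA i → XA i → YhA i → ℝ}
    (hμ : ∀ ω, 0 ≤ muCF p0 pX W κ ω) (hκs : ∀ i y x, ∑ yh, κ i y x yh = 1) (i : Fin n)
    (U : CFOmega X0A XA YA YdA YhA → α)
    (hU : ∀ ω v, U (ω.1, ω.2.1, ω.2.2.1, ω.2.2.2.1, Function.update ω.2.2.2.2 i v) = U ω)
    (hUY : ∀ ω ω', U ω = U ω' → ω.2.2.1 i = ω'.2.2.1 i ∧ ω.2.1 i = ω'.2.1 i) :
    entropy (muCF p0 pX W κ) (fun ω => (U ω, ω.2.2.2.2 i))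
      = entropy (muCF p0 pX W κ) U
        + expNegLog (muCF p0 pX W κ) fun ω => κ i (ω.2.2.1 i) (ω.2.1 i) (ω.2.2.2.2 i) := by
  refine entropy_pair_eq_add_expNegLog hμ U _
    (fun ω v => (ω.1, ω.2.1, ω.2.2.1, ω.2.2.2.1, Function.update ω.2.2.2.2 i v))
    (fun ω => p0 ω.1 * (∏ i, pX i (ω.2.1 i)) * W ω.1 ω.2.1 (ω.2.2.1, ω.2.2.2.1)
      * ∏ j ∈ Finset.univ.erase i, κ j (ω.2.2.1 j) (ω.2.1 j) (ω.2.2.2.2 j)) _ ?_ ?_ hU ?_ ?_ ?_ ?_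
  · intro ω
    rw [muCF, ← Finset.prod_erase_mul _ (fun j => κ j (ω.2.2.1 j) (ω.2.1 j) (ω.2.2.2.2 j))
      (Finset.mem_univ i), mul_assoc _ _ (κ i _ _ _)]
  · intro ω v
    congr 1
    refine Finset.prod_congr rfl fun j hj => ?_
    simp only [Function.update_of_ne (Finset.ne_of_mem_erase hj)]
  · simp
  · simp
  · simp [hκs]
  · intro ω ω' h h'
    obtain ⟨h1, h2⟩ := hUY ω ω' h
    simp only [h1, h2, h']

omit [DecidableEq YdA] [∀ i, DecidableEq (YA i)] [∀ i, DecidableEq (YhA i)] in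
lemma exists_entropy_rvXS {p0 : X0A → ℝ} {pX : ∀ i, XA i → ℝ}
    {W : X0A → (∀ i, XA i) → ((∀ i, YA i) × YdA) → ℝ} {κ : ∀ i, YA i → XA i → YhA i → ℝ}
    (hp0 : ∀ x, 0 ≤ p0 x) (hp0s : ∑ x, p0 x = 1)
    (hpX : ∀ i x, 0 ≤ pX i x) (hpXs : ∀ i, ∑ x, pX i x = 1)
    (hWs : ∀ x0 x, ∑ y, W x0 x y = 1) (hκs : ∀ i y x, ∑ yh, κ i y x yh = 1) :
    ∃ (h0 : ℝ) (h : Fin n → ℝ), ∀ S : Finset (Fin n),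
      entropy (muCF p0 pX W κ) (rvXS S) = ∑ i ∈ S, h i ∧
      entropy (muCF p0 pX W κ) (fun ω => (rvX0 ω, rvXS S ω)) = h0 + ∑ i ∈ S, h i := by
  set ν := inputMass p0 pX with hν
  let r : ∀ S : Finset (Fin n), (∀ i, XA i) → ∀ i : S, XA i := fun S x i => x i
  have hX : ∀ S, entropy (muCF p0 pX W κ) (rvXS S) = entropy ν (fun x => r S x.2) := fun S => by
    rw [hν, ← mass_muCF_inputs hWs hκs, ← entropy_comp]
    rfl
  have h0X : ∀ S, entropy (muCF p0 pX W κ) (fun ω => (rvX0 ω, rvXS S ω))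
      = entropy ν (fun x => (r S x.2, x.1)) := fun S => by
    rw [hν, ← mass_muCF_inputs hWs hκs, ← entropy_comp]
    refine entropy_congr _ fun ω ω' => ?_
    simp only [Prod.mk.injEq]
    exact and_comm
  have hsum : ∑ x, ν x = 1 := by
    simp only [hν, inputMass, Fintype.sum_prod_type, ← Finset.mul_sum, ← Fintype.prod_sum, hpXs,
      Finset.prod_const_one, mul_one, hp0s]
  have hr : ∀ S, entropy ν (fun x => r S x.2)
      = ∑ i ∈ S, expNegLog ν fun x => pX i (x.2 i) := by
    intro S
    induction S using Finset.induction_on with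
    | empty =>
      have huniv : ∀ x : X0A × (∀ i, XA i),
          mass ν (fun x => r ∅ x.2) (r ∅ x.2) = 1 := fun x => by
        rw [mass, Finset.filter_true_of_mem, hsum]
        intro y _
        funext i
        exact absurd i.2 (Finset.notMem_empty _)
      simp [entropy_eq_expNegLog, expNegLog, huniv]
    | insert i S hi ih =>
      rw [Finset.sum_insert hi, ← ih, add_comm, ← entropy_inputs_pair hp0 hpX hpXs]
      · refine entropy_congr _ fun x x' => ?_
        simp [r, funext_iff, and_comm]
      · intro x v
        funext j
        exact Function.update_of_ne (ne_of_mem_of_not_mem j.2 hi) _ _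
  refine ⟨expNegLog ν fun x => p0 x.1, fun i => expNegLog ν fun x => pX i (x.2 i), fun S => ?_⟩
  rw [hX, h0X, entropy_inputs_source hp0 hp0s hpX, hr, add_comm]
  exact ⟨rfl, rfl⟩

set_option synthInstance.maxHeartbeats 400000 in
set_option synthInstance.maxSize 1000 in
lemma exists_entropy_compressions {p0 : X0A → ℝ} {pX : ∀ i, XA i → ℝ}
    {W : X0A → (∀ i, XA i) → ((∀ i, YA i) × YdA) → ℝ} {κ : ∀ i, YA i → XA i → YhA i → ℝ}
    (hμ : ∀ ω, 0 ≤ muCF p0 pX W κ ω) (hκs : ∀ i y x, ∑ yh, κ i y x yh = 1) :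
    ∃ c : Fin n → ℝ, ∀ T S : Finset (Fin n), S ⊆ T →
      entropy (muCF p0 pX W κ)
          (fun ω => (rvYS S ω, rvYhS S ω, rvX0 ω, rvXS T ω, rvYd ω, rvYhS (T \ S) ω))
        = entropy (muCF p0 pX W κ)
          (fun ω => (rvYS S ω, rvX0 ω, rvXS T ω, rvYd ω, rvYhS (T \ S) ω)) + ∑ i ∈ S, c i := by
  refine ⟨fun i => expNegLog (muCF p0 pX W κ) fun ω =>
    κ i (ω.2.2.1 i) (ω.2.1 i) (ω.2.2.2.2 i), fun T S hST => ?_⟩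
  have key : ∀ B ⊆ S, entropy (muCF p0 pX W κ)
        (fun ω => (rvYS S ω, rvYhS B ω, rvX0 ω, rvXS T ω, rvYd ω, rvYhS (T \ S) ω))
      = entropy (muCF p0 pX W κ)
        (fun ω => (rvYS S ω, rvX0 ω, rvXS T ω, rvYd ω, rvYhS (T \ S) ω))
        + ∑ i ∈ B, expNegLog (muCF p0 pX W κ) fun ω =>
          κ i (ω.2.2.1 i) (ω.2.1 i) (ω.2.2.2.2 i) := by
    intro B
    induction B using Finset.induction_on with
    | empty =>
      intro _
      rw [Finset.sum_empty, add_zero]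
      refine entropy_congr _ fun ω ω' => ?_
      simp [Prod.mk.injEq, rvYhS_eq_iff]
    | insert i B hi ih =>
      intro hB
      obtain ⟨hiS, hBS⟩ := Finset.insert_subset_iff.1 hB
      rw [Finset.sum_insert hi, add_left_comm, ← ih hBS, add_comm,
        ← entropy_compression_pair hμ hκs]
      · refine entropy_congr _ fun ω ω' => ?_
        simp only [Prod.mk.injEq, rvYhS_eq_iff, Finset.forall_mem_insert]
        tauto
      · intro ω v
        simp only [Prod.mk.injEq, rvYhS_eq_iff]
        refine ⟨rfl, fun j hj => ?_, rfl, rfl, rfl, fun j hj => ?_⟩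
        · exact Function.update_of_ne (ne_of_mem_of_not_mem hj hi) _ _
        · exact Function.update_of_ne (ne_of_mem_of_not_mem hiS (Finset.mem_sdiff.1 hj).2).symm _ _
      · intro ω ω' h
        simp only [Prod.mk.injEq, rvYS_eq_iff, rvXS_eq_iff] at h
        exact ⟨h.1 i hiS, h.2.2.2.1 i (hST hiS)⟩
  exact key S subset_rfl

set_option synthInstance.maxHeartbeats 400000 in
set_option synthInstance.maxSize 1000 in
/-- Both `cfGap` and the expression minimized in `Gfun` are differences of values of two set
functions, which satisfy a mixed submodularity inequality. -/
lemma exists_setFunctions {p0 : X0A → ℝ} {pX : ∀ i, XA i → ℝ}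
    {W : X0A → (∀ i, XA i) → ((∀ i, YA i) × YdA) → ℝ} {κ : ∀ i, YA i → XA i → YhA i → ℝ}
    (hp0 : ∀ x, 0 ≤ p0 x) (hp0s : ∑ x, p0 x = 1)
    (hpX : ∀ i x, 0 ≤ pX i x) (hpXs : ∀ i, ∑ x, pX i x = 1)
    (hW : ∀ x0 x y, 0 ≤ W x0 x y) (hWs : ∀ x0 x, ∑ y, W x0 x y = 1)
    (hκ : ∀ i y x yh, 0 ≤ κ i y x yh) (hκs : ∀ i y x, ∑ yh, κ i y x yh = 1) :
    ∃ φ ψ : Finset (Fin n) → ℝ,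
      (∀ T S, S ⊆ T → cfGap (muCF p0 pX W κ) T S = φ (T \ S) - φ T) ∧
      (∀ T S, S ⊆ T →
        condMI (muCF p0 pX W κ) (fun ω => (rvX0 ω, rvXS S ω))
            (fun ω => (rvYhS (T \ S) ω, rvYd ω)) (rvXS (T \ S))
          - condMI (muCF p0 pX W κ) (rvYS S) (rvYhS S)
            (fun ω => (rvX0 ω, rvXS T ω, rvYd ω, rvYhS (T \ S) ω)) = ψ (T \ S) - φ T) ∧
      ∀ A T, ψ (T ∩ A) + φ (A ∪ T) ≤ ψ A + φ T := by
  have hμ := muCF_nonneg hp0 hpX hW hκ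
  obtain ⟨h0, h, hX⟩ := exists_entropy_rvXS hp0 hp0s hpX hpXs hWs hκs
  obtain ⟨c, hc⟩ := exists_entropy_compressions hμ hκs
  set μ := muCF p0 pX W κ
  let F : Finset (Fin n) → ℝ := fun A =>
    entropy μ fun ω => (rvX0 ω, rvXS A ω, rvYhS A ω, rvYd ω)
  let K : Finset (Fin n) → ℝ := fun A => entropy μ fun ω => (rvXS A ω, rvYhS A ω, rvYd ω)
  have split : ∀ (T S : Finset (Fin n)), S ⊆ T → ∀ p : Fin n → Prop,
      ((∀ i ∈ T, p i) ↔ (∀ i ∈ S, p i) ∧ ∀ i ∈ T \ S, p i) := by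
    intro T S hST p
    rw [← Finset.forall_mem_union, Finset.union_sdiff_of_subset hST]
  have compression_term : ∀ T S, S ⊆ T → condMI μ (rvYS S) (rvYhS S)
      (fun ω => (rvX0 ω, rvXS T ω, rvYd ω, rvYhS (T \ S) ω))
      = F T - ∑ i ∈ S, c i
        - entropy μ (fun ω => (rvX0 ω, rvXS T ω, rvYd ω, rvYhS (T \ S) ω)) := by
    intro T S hST
    have e : entropy μ (fun ω => (rvYhS S ω, rvX0 ω, rvXS T ω, rvYd ω, rvYhS (T \ S) ω)) = F T :=
      entropy_congr _ fun ω ω' => by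
        simp only [Prod.mk.injEq, rvYhS_eq_iff, split T S hST fun i => ω.2.2.2.2 i = ω'.2.2.2.2 i]
        tauto
    rw [condMI, hc T S hST, e]
    ring
  refine ⟨fun A => F A - ∑ i ∈ A, h i - ∑ i ∈ A, c i,
    fun A => h0 + K A - ∑ i ∈ A, h i - ∑ i ∈ A, c i, ?_, ?_, ?_⟩
  · intro T S hST
    have e1 : entropy μ (fun ω => (rvXS S ω, rvX0 ω, rvXS (T \ S) ω)) = h0 + ∑ i ∈ T, h i := by
      rw [← (hX T).2]
      refine entropy_congr _ fun ω ω' => ?_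
      simp only [Prod.mk.injEq, rvXS_eq_iff, split T S hST fun i => ω.2.1 i = ω'.2.1 i]
      tauto
    have e2 : entropy μ (fun ω => ((rvYhS (T \ S) ω, rvYd ω), rvX0 ω, rvXS (T \ S) ω))
        = F (T \ S) :=
      entropy_congr _ fun ω ω' => by
        simp only [Prod.mk.injEq]
        tauto
    have e3 : entropy μ (fun ω => (rvXS S ω, (rvYhS (T \ S) ω, rvYd ω), rvX0 ω, rvXS (T \ S) ω))
        = entropy μ (fun ω => (rvX0 ω, rvXS T ω, rvYd ω, rvYhS (T \ S) ω)) :=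
      entropy_congr _ fun ω ω' => by
        simp only [Prod.mk.injEq, rvXS_eq_iff, split T S hST fun i => ω.2.1 i = ω'.2.1 i]
        tauto
    rw [cfGap, compression_term T S hST, condMI, e1, e2, e3, (hX (T \ S)).2]
    linarith [Finset.sum_sdiff (f := c) hST]
  · intro T S hST
    have e1 : entropy μ (fun ω => ((rvX0 ω, rvXS S ω), rvXS (T \ S) ω)) = h0 + ∑ i ∈ T, h i := by
      rw [← (hX T).2]
      refine entropy_congr _ fun ω ω' => ?_
      simp only [Prod.mk.injEq, rvXS_eq_iff, split T S hST fun i => ω.2.1 i = ω'.2.1 i]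
      tauto
    have e2 : entropy μ (fun ω => ((rvYhS (T \ S) ω, rvYd ω), rvXS (T \ S) ω)) = K (T \ S) :=
      entropy_congr _ fun ω ω' => by
        simp only [Prod.mk.injEq]
        tauto
    have e3 : entropy μ
          (fun ω => ((rvX0 ω, rvXS S ω), (rvYhS (T \ S) ω, rvYd ω), rvXS (T \ S) ω))
        = entropy μ (fun ω => (rvX0 ω, rvXS T ω, rvYd ω, rvYhS (T \ S) ω)) :=
      entropy_congr _ fun ω ω' => by
        simp only [Prod.mk.injEq, rvXS_eq_iff, split T S hST fun i => ω.2.1 i = ω'.2.1 i]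
        tauto
    rw [compression_term T S hST, condMI, e1, e2, e3, (hX (T \ S)).1]
    linarith [Finset.sum_sdiff (f := c) hST]
  · intro A T
    have hI := condMI_nonneg hμ (fun ω => (rvXS A ω, rvYhS A ω))
      (fun ω => (rvX0 ω, rvXS T ω, rvYhS T ω))
      (fun ω => (rvXS (T ∩ A) ω, rvYhS (T ∩ A) ω, rvYd ω))
    have e1 : entropy μ (fun ω => ((rvXS A ω, rvYhS A ω),
        rvXS (T ∩ A) ω, rvYhS (T ∩ A) ω, rvYd ω)) = K A :=
      entropy_congr _ fun ω ω' => by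
        simp only [Prod.mk.injEq, rvXS_eq_iff, rvYhS_eq_iff, Finset.mem_inter]
        grind
    have e2 : entropy μ (fun ω => ((rvX0 ω, rvXS T ω, rvYhS T ω),
        rvXS (T ∩ A) ω, rvYhS (T ∩ A) ω, rvYd ω)) = F T :=
      entropy_congr _ fun ω ω' => by
        simp only [Prod.mk.injEq, rvXS_eq_iff, rvYhS_eq_iff, Finset.mem_inter]
        grind
    have e3 : entropy μ (fun ω => ((rvXS A ω, rvYhS A ω), (rvX0 ω, rvXS T ω, rvYhS T ω),
        rvXS (T ∩ A) ω, rvYhS (T ∩ A) ω, rvYd ω)) = F (A ∪ T) :=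
      entropy_congr _ fun ω ω' => by
        simp only [Prod.mk.injEq, rvXS_eq_iff, rvYhS_eq_iff, Finset.mem_inter, Finset.mem_union]
        grind
    rw [condMI, e1, e2, e3] at hI
    have e4 : entropy μ (fun ω => (rvXS (T ∩ A) ω, rvYhS (T ∩ A) ω, rvYd ω)) = K (T ∩ A) := rfl
    rw [e4] at hI
    have hh := Finset.sum_union_inter (s₁ := A) (s₂ := T) (f := h)
    have hcc := Finset.sum_union_inter (s₁ := A) (s₂ := T) (f := c)
    rw [Finset.inter_comm] at hh hcc
    linarith

end CFEntropy

/-- `G` attains its maximum over all subsets of `N` at both the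
unique largest strictly decodable subset `D` and the unique largest weakly decodable
subset `D'`: `G(D) = G(D') = max_{T ⊆ N} G(T)`. -/
theorem Gfun_max_at_largest_decodable
    {n : ℕ} {X0A YdA : Type} {XA YA YhA : Fin n → Type}
    [Fintype X0A] [DecidableEq X0A] [Fintype YdA] [DecidableEq YdA]
    [∀ i, Fintype (XA i)] [∀ i, DecidableEq (XA i)]
    [∀ i, Fintype (YA i)] [∀ i, DecidableEq (YA i)]
    [∀ i, Fintype (YhA i)] [∀ i, DecidableEq (YhA i)]
    (p0 : X0A → ℝ) (pX : ∀ i, XA i → ℝ)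
    (W : X0A → (∀ i, XA i) → ((∀ i, YA i) × YdA) → ℝ)
    (κ : ∀ i, YA i → XA i → YhA i → ℝ)
    (hp0 : ∀ x, 0 ≤ p0 x) (hp0s : ∑ x, p0 x = 1)
    (hpX : ∀ i x, 0 ≤ pX i x) (hpXs : ∀ i, ∑ x, pX i x = 1)
    (hW : ∀ x0 x y, 0 ≤ W x0 x y) (hWs : ∀ x0 x, ∑ y, W x0 x y = 1)
    (hκ : ∀ i y x yh, 0 ≤ κ i y x yh) (hκs : ∀ i y x, ∑ yh, κ i y x yh = 1)
    (D D' : Finset (Fin n))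
    (hD : StrictlyDecodable (muCF p0 pX W κ) D)
    (hDmax : ∀ E : Finset (Fin n), StrictlyDecodable (muCF p0 pX W κ) E → E ⊆ D)
    (hD' : WeaklyDecodable (muCF p0 pX W κ) D')
    (hD'max : ∀ E : Finset (Fin n), WeaklyDecodable (muCF p0 pX W κ) E → E ⊆ D') :
    Gfun (muCF p0 pX W κ) D =
      (Finset.univ : Finset (Fin n)).powerset.sup'
        (Finset.powerset_nonempty _) (Gfun (muCF p0 pX W κ)) ∧
    Gfun (muCF p0 pX W κ) D' =
      (Finset.univ : Finset (Fin n)).powerset.sup'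
        (Finset.powerset_nonempty _) (Gfun (muCF p0 pX W κ)) := by
  obtain ⟨φ, ψ, hgap, hG, hsub⟩ :=
    exists_setFunctions hp0 hp0s hpX hpXs hW hWs hκ hκs
  set μ := muCF p0 pX W κ
  have max_of_min : ∀ E, (∀ T, φ E ≤ φ T) →
      Gfun μ E = (Finset.univ : Finset (Fin n)).powerset.sup'
        (Finset.powerset_nonempty _) (Gfun μ) := by
    intro E hE
    refine le_antisymm (Finset.le_sup' _ (by simp)) (Finset.sup'_le _ _ fun T _ => ?_)
    refine Finset.le_inf' _ _ fun S hS => ?_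
    rw [hG E S (Finset.mem_powerset.1 hS)]
    refine (Finset.inf'_le _ (Finset.mem_powerset.2
      (Finset.sdiff_subset (s := T) (t := E \ S)))).trans ?_
    rw [hG T _ Finset.sdiff_subset, sdiff_sdiff_right_self, Finset.inf_eq_inter]
    linarith [hsub (E \ S) T, hE (E \ S ∪ T)]
  obtain ⟨M, hM⟩ := Finite.exists_min φ
  obtain ⟨L, hL, hLmin⟩ := Set.Finite.exists_minimal
    (Set.toFinite {L : Finset (Fin n) | ∀ T, φ L ≤ φ T}) ⟨M, hM⟩
  have hLD : L ⊆ D := hDmax L fun S hS hne => by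
    rw [hgap L S hS, sub_pos]
    by_contra! hle
    obtain ⟨i, hi⟩ := hne
    have := hLmin (y := L \ S) (fun T => hle.trans (hL T)) Finset.sdiff_subset (hS hi)
    exact (Finset.mem_sdiff.1 this).2 hi
  have hMD' : M ⊆ D' := hD'max M fun S hS => by
    rw [hgap M S hS, sub_nonneg]
    exact hM _
  constructor
  · refine max_of_min D fun T => ?_
    rcases (D \ L).eq_empty_or_nonempty with h | h
    · rw [Finset.Subset.antisymm (Finset.sdiff_eq_empty_iff_subset.1 h) hLD]
      exact hL T
    · have := hD _ Finset.sdiff_subset h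
      rw [hgap D _ Finset.sdiff_subset, Finset.sdiff_sdiff_eq_self hLD] at this
      linarith [hL T]
  · refine max_of_min D' fun T => ?_
    have := hD' _ (Finset.sdiff_subset (t := M))
    rw [hgap D' _ Finset.sdiff_subset, Finset.sdiff_sdiff_eq_self hMD'] at this
    linarith [hM T]
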